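/- arXiv:1411.6488 — 6 statements merged into one kernel-verified Lean document; each statement's English description precedes it below -/
import Mathlib

section
/- Let α ∈ ℂ and let t : ℂ → ℂ be of t-form. If Q : ℂ → ℂ is a trigonometric polynomial (i.e. Q(λ) = P(e^λ) for some Laurent polynomial P ∈ ℂ[X, X⁻¹]) satisfying t(λ)Q(λ) = −e^{λ−α} a(λ) Q(λ−η) + e^{−λ−η+α} d(λ) Q(λ+η) for all λ ∈ ℂ, then Q is identically zero. -/
open Complex Finset

noncomputable section

/-- Shifted inhomogeneity parameter `ξ_n^{(k)} = ξ_n + (s_n − k) η`, where `σ n = 2 s_n`. -/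
def xik {N : ℕ} (η : ℂ) (σ : Fin N → ℕ) (ξ : Fin N → ℂ) (n : Fin N) (k : ℕ) : ℂ :=
  ξ n + ((σ n : ℂ) / 2 - (k : ℂ)) * η

/-- `a(λ) = ∏ₙ sinh (λ − ξ_n + s_n η)`. -/
def afun {N : ℕ} (η : ℂ) (σ : Fin N → ℕ) (ξ : Fin N → ℂ) (lam : ℂ) : ℂ :=
  ∏ n, Complex.sinh (lam - ξ n + ((σ n : ℂ) / 2) * η)

/-- `d(λ) = ∏ₙ sinh (λ − ξ_n − s_n η)`. -/
def dfun {N : ℕ} (η : ℂ) (σ : Fin N → ℕ) (ξ : Fin N → ℂ) (lam : ℂ) : ℂ :=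
  ∏ n, Complex.sinh (lam - ξ n - ((σ n : ℂ) / 2) * η)

/-- `t` is of t-form: `t(λ) = e^{−(N−1)λ} ∑_{j=0}^{N−1} c_j e^{2jλ}`. -/
def tForm (N : ℕ) (t : ℂ → ℂ) : Prop :=
  ∃ c : Fin N → ℂ, ∀ lam : ℂ,
    t lam = Complex.exp (-((N : ℂ) - 1) * lam) * ∑ j, c j * Complex.exp (2 * ((j : ℕ) : ℂ) * lam)

/-- The `(2s_n+1) × (2s_n+1)` tridiagonal matrix `D_t^{(n)}`. -/
def Dmat {N : ℕ} (η : ℂ) (σ : Fin N → ℕ) (ξ : Fin N → ℂ) (t : ℂ → ℂ) (n : Fin N) :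
    Matrix (Fin (σ n + 1)) (Fin (σ n + 1)) ℂ :=
  Matrix.of fun h k =>
    if (h : ℕ) = (k : ℕ) then t (xik η σ ξ n (h : ℕ))
    else if (k : ℕ) = (h : ℕ) + 1 then afun η σ ξ (xik η σ ξ n (h : ℕ))
    else if (h : ℕ) = (k : ℕ) + 1 then -(dfun η σ ξ (xik η σ ξ n (h : ℕ)))
    else 0

/-- The set `Ξ_i = {ξ_i + kη + k′ iπ : k ∈ {−s_i, …, s_i}, k′ ∈ ℤ}`. -/
def XiSet {N : ℕ} (η : ℂ) (σ : Fin N → ℕ) (ξ : Fin N → ℂ) (i : Fin N) : Set ℂ :=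
  {z : ℂ | ∃ k : ℕ, k ≤ σ i ∧ ∃ k' : ℤ, z = xik η σ ξ i k + (k' : ℂ) * ((Real.pi : ℂ) * Complex.I)}

/-- Condition (C): the sets `Ξ_i` are pairwise disjoint. -/
def CondC {N : ℕ} (η : ℂ) (σ : Fin N → ℕ) (ξ : Fin N → ℂ) : Prop :=
  ∀ i j : Fin N, i ≠ j → XiSet η σ ξ i ∩ XiSet η σ ξ j = ∅

/-- The inhomogeneous term `F_x(λ)`. -/
def Ffun {N : ℕ} (η : ℂ) (σ : Fin N → ℕ) (ξ : Fin N → ℂ) (x lam : ℂ) : ℂ :=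
  2 * Complex.exp (-(((∑ n, σ n : ℕ) : ℂ) + 1) * η / 2) *
    Complex.sinh (lam - x + (∑ j, ∑ h ∈ Finset.Icc 1 (σ j), xik η σ ξ j h)
      + (((∑ n, σ n : ℕ) : ℂ) + 1) * η / 2) *
    ∏ j, ∏ h ∈ Finset.range (σ j + 1), Complex.sinh (lam - xik η σ ξ j h)

/-- `w_ε(λ) = 2 ε (i/2)^{N_s} ∏ₙ ∏_{h=1}^{2s_n−1} sinh(λ − ξ_n^{(h)})`. -/
def wfun {N : ℕ} (η : ℂ) (σ : Fin N → ℕ) (ξ : Fin N → ℂ) (ε lam : ℂ) : ℂ :=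
  2 * ε * (Complex.I / 2) ^ (∑ n, σ n) *
    ∏ n, ∏ h ∈ Finset.Icc 1 (σ n - 1), Complex.sinh (lam - xik η σ ξ n h)

open Filter Topology

/-- `e^{kx} → 0` as `x → +∞` for a negative integer `k`. -/
lemma tendsto_cexp_int_mul_atTop {k : ℤ} (hk : k < 0) :
    Tendsto (fun x : ℝ => Complex.exp ((k : ℂ) * (x : ℂ))) atTop (𝓝 0) := by
  rw [Complex.tendsto_exp_nhds_zero_iff]
  have hre : ∀ x : ℝ, ((k : ℂ) * (x : ℂ)).re = (k : ℝ) * x := fun x => by simp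
  simp only [hre]
  exact tendsto_id.const_mul_atTop_of_neg (by exact_mod_cast hk)

/-- `sinh (x + c) e^{-x} → e^c / 2` as `x → +∞`. -/
lemma tendsto_sinh_mul_exp_neg_atTop (c : ℂ) :
    Tendsto (fun x : ℝ => Complex.sinh ((x : ℂ) + c) * Complex.exp (-(x : ℂ))) atTop
      (𝓝 (Complex.exp c / 2)) := by
  have h := (((tendsto_cexp_int_mul_atTop (k := -2) (by norm_num)).const_mul
    (Complex.exp (-c))).const_sub (Complex.exp c)).div_const 2
  rw [mul_zero, sub_zero] at h
  refine h.congr fun x => ?_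
  rw [Complex.sinh, div_mul_eq_mul_div, sub_mul, ← Complex.exp_add, ← Complex.exp_add,
    ← Complex.exp_add]
  congr 3
  · ring
  · push_cast
    ring

/-- A product of `N` shifted `sinh`, divided by `e^{Nx}`, has a nonzero limit as `x → +∞`. -/
lemma tendsto_prod_sinh_mul_exp_neg_atTop {N : ℕ} (c : Fin N → ℂ) :
    Tendsto (fun x : ℝ => (∏ n, Complex.sinh ((x : ℂ) + c n)) * Complex.exp (-(N : ℂ) * (x : ℂ)))
      atTop (𝓝 (∏ n, Complex.exp (c n) / 2)) := by
  refine (tendsto_finsetProd _ fun n _ => tendsto_sinh_mul_exp_neg_atTop (c n)).congr fun x => ?_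
  rw [Finset.prod_mul_distrib, Finset.prod_const, Finset.card_univ, Fintype.card_fin,
    ← Complex.exp_nat_mul]
  congr 2
  ring

/-- A trigonometric polynomial of degree at most `m`, shifted by `c` and divided by `e^{mx}`, tends
to its coefficient of degree `m` times `e^{mc}`. -/
lemma tendsto_trigPoly_mul_exp_neg_atTop (P : ℤ →₀ ℂ) {m : ℤ} (hm : ∀ k ∈ P.support, k ≤ m)
    (c : ℂ) :
    Tendsto (fun x : ℝ => (P.sum fun k ck => ck * Complex.exp ((k : ℂ) * ((x : ℂ) + c))) *
      Complex.exp (-(m : ℂ) * (x : ℂ))) atTop (𝓝 (P m * Complex.exp ((m : ℂ) * c))) := by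
  have h : Tendsto (fun x : ℝ => ∑ k ∈ P.support,
      P k * Complex.exp ((k : ℂ) * c) * Complex.exp (((k - m : ℤ) : ℂ) * (x : ℂ))) atTop
      (𝓝 (∑ k ∈ P.support, if k = m then P k * Complex.exp ((k : ℂ) * c) else 0)) := by
    refine tendsto_finsetSum _ fun k hk => ?_
    split_ifs with hkm
    · simp [hkm]
    · simpa using (tendsto_cexp_int_mul_atTop (k := k - m)
        (sub_neg.2 (lt_of_le_of_ne (hm k hk) hkm))).const_mul (P k * Complex.exp ((k : ℂ) * c))
  have hsum : (∑ k ∈ P.support, if k = m then P k * Complex.exp ((k : ℂ) * c) else 0) =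
      P m * Complex.exp ((m : ℂ) * c) := by
    rw [Finset.sum_ite_eq']
    split_ifs with hmem
    · rfl
    · rw [Finsupp.notMem_support_iff.1 hmem, zero_mul]
  rw [hsum] at h
  refine h.congr fun x => ?_
  rw [Finsupp.sum, Finset.sum_mul]
  refine Finset.sum_congr rfl fun k _ => ?_
  rw [mul_assoc, mul_assoc, ← Complex.exp_add, ← Complex.exp_add]
  congr 2
  push_cast
  ring

/-- A function of t-form is `o(e^{(N+1)x})` as `x → +∞`. -/
lemma tForm.tendsto_mul_exp_neg_atTop {N : ℕ} {t : ℂ → ℂ} (ht : tForm N t) :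
    Tendsto (fun x : ℝ => t (x : ℂ) * Complex.exp (-((N : ℂ) + 1) * (x : ℂ))) atTop (𝓝 0) := by
  obtain ⟨c, hc⟩ := ht
  have h : Tendsto (fun x : ℝ => ∑ j : Fin N,
      c j * Complex.exp (((2 * (j : ℕ) - 2 * N : ℤ) : ℂ) * (x : ℂ))) atTop
      (𝓝 (∑ j : Fin N, c j * 0)) :=
    tendsto_finsetSum _ fun j _ =>
      (tendsto_cexp_int_mul_atTop (by have := j.isLt; omega)).const_mul (c j)
  simp only [mul_zero, Finset.sum_const_zero] at h
  refine h.congr fun x => ?_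
  rw [hc, mul_comm (Complex.exp _), Finset.sum_mul, Finset.sum_mul]
  refine Finset.sum_congr rfl fun j _ => ?_
  rw [mul_assoc, mul_assoc, ← Complex.exp_add, ← Complex.exp_add]
  congr 2
  push_cast
  ring

/-- if `t` is of t-form and a trigonometric polynomial `Q` (a Laurent polynomial
`P ∈ ℂ[X,X⁻¹]` evaluated at `e^λ`) solves the homogeneous equation
`t(λ)Q(λ) = −e^{λ−α} a(λ) Q(λ−η) + e^{−λ−η+α} d(λ) Q(λ+η)`, then `Q ≡ 0`. -/
theorem stmt_0 {N : ℕ} (hN : 1 ≤ N) (σ : Fin N → ℕ) (hσ : ∀ n, 1 ≤ σ n)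
    (η : ℂ) (hη : ∀ r : ℚ, η ≠ (r : ℂ) * ((Real.pi : ℂ) * Complex.I))
    (ξ : Fin N → ℂ) (α : ℂ) (t : ℂ → ℂ) (ht : tForm N t)
    (Q : ℂ → ℂ) (P : ℤ →₀ ℂ)
    (hQ : ∀ lam : ℂ, Q lam = P.sum fun k ck => ck * Complex.exp ((k : ℂ) * lam))
    (heq : ∀ lam : ℂ, t lam * Q lam =
      -Complex.exp (lam - α) * afun η σ ξ lam * Q (lam - η)
        + Complex.exp (-lam - η + α) * dfun η σ ξ lam * Q (lam + η)) :
    ∀ lam : ℂ, Q lam = 0 := by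
  by_cases hP : P = 0
  · intro lam
    simp [hQ, hP]
  exfalso
  have hne : P.support.Nonempty := Finsupp.support_nonempty_iff.2 hP
  set m := P.support.max' hne
  have hPm : P m ≠ 0 := Finsupp.mem_support_iff.1 (P.support.max'_mem hne)
  have hQlim (c : ℂ) : Tendsto (fun x : ℝ => Q ((x : ℂ) + c) * Complex.exp (-(m : ℂ) * (x : ℂ)))
      atTop (𝓝 (P m * Complex.exp ((m : ℂ) * c))) := by
    simp only [hQ]
    exact tendsto_trigPoly_mul_exp_neg_atTop P (fun k hk => P.support.le_max' k hk) c
  have ha : Tendsto (fun x : ℝ => afun η σ ξ (x : ℂ) * Complex.exp (-(N : ℂ) * (x : ℂ))) atTop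
      (𝓝 (∏ n, Complex.exp (-ξ n + ((σ n : ℂ) / 2) * η) / 2)) := by
    refine (tendsto_prod_sinh_mul_exp_neg_atTop _).congr fun x => ?_
    simp only [afun, sub_eq_add_neg, add_assoc]
  have hd : Tendsto (fun x : ℝ => dfun η σ ξ (x : ℂ) * Complex.exp (-(N : ℂ) * (x : ℂ))) atTop
      (𝓝 (∏ n, Complex.exp (-ξ n + -(((σ n : ℂ) / 2) * η)) / 2)) := by
    refine (tendsto_prod_sinh_mul_exp_neg_atTop _).congr fun x => ?_
    simp only [dfun, sub_eq_add_neg, add_assoc]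
  have hleft := ht.tendsto_mul_exp_neg_atTop.mul (hQlim 0)
  have hright := ((ha.mul (hQlim (-η))).const_mul (-Complex.exp (-α))).add
    (((tendsto_cexp_int_mul_atTop (k := -2) (by norm_num)).const_mul (Complex.exp (-η + α))).mul
      (hd.mul (hQlim η)))
  rw [zero_mul] at hleft
  rw [mul_zero, zero_mul, add_zero] at hright
  have hlim := tendsto_nhds_unique (hright.congr fun x => ?_) hleft
  · refine absurd hlim (mul_ne_zero (neg_ne_zero.2 (Complex.exp_ne_zero _)) (mul_ne_zero
      (Finset.prod_ne_zero_iff.2 fun n _ => div_ne_zero (Complex.exp_ne_zero _) two_ne_zero)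
      (mul_ne_zero hPm (Complex.exp_ne_zero _))))
  · have h := heq x
    have e1 : Complex.exp ((x : ℂ) - α) * Complex.exp (-(x : ℂ)) = Complex.exp (-α) := by
      rw [← Complex.exp_add]; congr 1; ring
    have e2 : Complex.exp (-(x : ℂ) - η + α) * Complex.exp (-(x : ℂ)) =
        Complex.exp (-η + α) * Complex.exp (((-2 : ℤ) : ℂ) * (x : ℂ)) := by
      rw [← Complex.exp_add, ← Complex.exp_add]; congr 1; push_cast; ring
    have e3 : Complex.exp (-((N : ℂ) + 1) * (x : ℂ)) =
        Complex.exp (-(N : ℂ) * (x : ℂ)) * Complex.exp (-(x : ℂ)) := by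
      rw [← Complex.exp_add]; congr 1; ring
    rw [add_zero, e3, ← e1, ← e2, ← sub_eq_add_neg]
    linear_combination (-(Complex.exp (-(N : ℂ) * (x : ℂ)) * Complex.exp (-(x : ℂ)) *
      Complex.exp (-(m : ℂ) * (x : ℂ)))) * h
end
end

section
/- Let α ∈ ℂ, let t : ℂ → ℂ be of t-form, let N_Q ∈ ℕ, and let Q(λ) = e^{−N_Q λ}·∑_{j=0}^{N_Q} c_j e^{2jλ} for complex coefficients c_0,…,c_{N_Q}. Define F(λ) = t(λ)Q(λ) + e^{λ−α} a(λ) Q(λ−η) − e^{−λ−η+α} d(λ) Q(λ+η). If there exist N + N_Q + 1 points μ_0,…,μ_{N+N_Q} ∈ ℂ, pairwise distinct modulo iπ, at which F vanishes, then either Q is identically zero, or both c_0 ≠ 0 and c_{N_Q} ≠ 0. -/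
open Complex Finset

noncomputable section

/-- `∏ₙ sinh (λ − bₙ)` is `e^{−Nλ}` times a polynomial of degree at most `N` in `e^{2λ}` with
nonzero constant term. -/
theorem exists_polynomial_prod_sinh {N : ℕ} (b : Fin N → ℂ) :
    ∃ P : Polynomial ℂ, P.natDegree ≤ N ∧ P.eval 0 ≠ 0 ∧
      ∀ z : ℂ, Complex.exp (N * z) * ∏ n, Complex.sinh (z - b n) =
        P.eval (Complex.exp (2 * z)) := by
  refine ⟨∏ n, (Polynomial.C (Complex.exp (-b n) / 2) * Polynomial.X
    + Polynomial.C (-(Complex.exp (b n) / 2))), ?_, ?_, ?_⟩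
  · refine (Polynomial.natDegree_prod_le _ _).trans ?_
    exact (Finset.sum_le_card_nsmul _ _ 1 fun n _ => Polynomial.natDegree_linear_le).trans (by simp)
  · simp [Polynomial.eval_prod, Finset.prod_eq_zero_iff]
  · intro z
    have hpow : Complex.exp (N * z) = ∏ _n : Fin N, Complex.exp z := by
      simp [Complex.exp_nat_mul]
    rw [hpow, ← Finset.prod_mul_distrib, Polynomial.eval_prod]
    refine Finset.prod_congr rfl fun n _ => ?_
    simp only [Polynomial.eval_add, Polynomial.eval_mul, Polynomial.eval_C, Polynomial.eval_X,
      Complex.sinh]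
    have h1 : Complex.exp (z - b n) = Complex.exp z * Complex.exp (-b n) := by
      rw [← Complex.exp_add]; ring_nf
    have h2 : Complex.exp z * Complex.exp (-(z - b n)) = Complex.exp (b n) := by
      rw [← Complex.exp_add]; ring_nf
    have h3 : Complex.exp (2 * z) = Complex.exp z * Complex.exp z := by
      rw [← Complex.exp_add]; ring_nf
    rw [h1, h3, ← h2]
    ring

/-- A polynomial killed by `X·T + X·A·S_u − D·S_v`, where `S_u` is the dilation `p(x) ↦ p(ux)`,
vanishes if `D(0) ≠ 0` and `v ≠ 0`. -/
theorem eq_zero_of_dilation_equation {K : Type*} [Field K] {T A D q : Polynomial K} {u v : K}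
    (hv : v ≠ 0) (hD : D.eval 0 ≠ 0)
    (h : Polynomial.X * (T * q) + Polynomial.X * (A * q.comp (Polynomial.C u * Polynomial.X))
      - D * q.comp (Polynomial.C v * Polynomial.X) = 0) : q = 0 := by
  by_contra hq
  obtain ⟨r, hr, hr0⟩ := Polynomial.exists_eq_pow_rootMultiplicity_mul_and_not_dvd q hq 0
  generalize q.rootMultiplicity 0 = m at hr
  simp only [Polynomial.C_0, sub_zero] at hr hr0
  rw [Polynomial.X_dvd_iff, Polynomial.coeff_zero_eq_eval_zero] at hr0
  have hfac : (Polynomial.X : Polynomial K) ^ m *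
      (Polynomial.X * (T * r) +
        Polynomial.X * (A * (Polynomial.C u ^ m * r.comp (Polynomial.C u * Polynomial.X)))
      - D * (Polynomial.C v ^ m * r.comp (Polynomial.C v * Polynomial.X))) = 0 := by
    rw [← h, hr]
    simp only [Polynomial.mul_comp, Polynomial.X_pow_comp]
    ring
  have h0 := congrArg (Polynomial.eval 0)
    ((mul_eq_zero.mp hfac).resolve_left (pow_ne_zero _ Polynomial.X_ne_zero))
  simp [Polynomial.eval_comp] at h0
  tauto

/-- If `X·T·q + X·A·S_u q − D·S_v q` has at least `N + M + 1` distinct nonzero zeros, where `q`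
is nonzero of degree at most `M`, then both extreme coefficients of `q` are nonzero. -/
theorem coeff_ne_zero_of_dilation_roots {K : Type*} [Field K] {N M : ℕ}
    {T A D q : Polynomial K} {u v : K} (hv : v ≠ 0) (hD : D.eval 0 ≠ 0)
    (hTdeg : T.natDegree ≤ N) (hAdeg : A.natDegree ≤ N) (hDdeg : D.natDegree ≤ N)
    (hq : q ≠ 0) (hqdeg : q.natDegree ≤ M) {x : Fin (N + M + 1) → K}
    (hx : Function.Injective x) (hx0 : ∀ i, x i ≠ 0)
    (hroot : ∀ i, (Polynomial.X * (T * q)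
      + Polynomial.X * (A * q.comp (Polynomial.C u * Polynomial.X))
      - D * q.comp (Polynomial.C v * Polynomial.X)).eval (x i) = 0) :
    q.coeff 0 ≠ 0 ∧ q.coeff M ≠ 0 := by
  have hcomp (w : K) : (q.comp (Polynomial.C w * Polynomial.X)).natDegree ≤ q.natDegree :=
    Polynomial.natDegree_comp_le.trans
      ((Nat.mul_le_mul_left _ ((Polynomial.natDegree_C_mul_le w _).trans
        Polynomial.natDegree_X_le)).trans (mul_one _).le)
  have hG : Polynomial.X * (T * q)
      + Polynomial.X * (A * q.comp (Polynomial.C u * Polynomial.X))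
      - D * q.comp (Polynomial.C v * Polynomial.X) ≠ 0 :=
    fun h => hq (eq_zero_of_dilation_equation hv hD h)
  have hGdeg : (Polynomial.X * (T * q)
      + Polynomial.X * (A * q.comp (Polynomial.C u * Polynomial.X))
      - D * q.comp (Polynomial.C v * Polynomial.X)).natDegree ≤ N + q.natDegree + 1 := by
    refine (Polynomial.natDegree_sub_le_of_le (Polynomial.natDegree_add_le_of_degree_le
      (n := N + q.natDegree + 1) ?_ ?_) (?_ : _ ≤ N + q.natDegree + 1)).trans (max_self _).le
    · rw [add_comm]
      exact Polynomial.natDegree_mul_le_of_le Polynomial.natDegree_X_le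
        (Polynomial.natDegree_mul_le_of_le hTdeg le_rfl)
    · rw [add_comm]
      exact Polynomial.natDegree_mul_le_of_le Polynomial.natDegree_X_le
        (Polynomial.natDegree_mul_le_of_le hAdeg (hcomp u))
    · exact (Polynomial.natDegree_mul_le_of_le hDdeg (hcomp v)).trans (Nat.le_succ _)
  generalize hGdef : Polynomial.X * (T * q)
      + Polynomial.X * (A * q.comp (Polynomial.C u * Polynomial.X))
      - D * q.comp (Polynomial.C v * Polynomial.X) = G at hroot hG hGdeg
  constructor
  · intro h0
    have hG0 : G.coeff 0 = 0 := by
      rw [Polynomial.coeff_zero_eq_eval_zero] at h0 ⊢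
      simp [← hGdef, Polynomial.eval_comp, h0]
    have hX : Polynomial.X * G.divX = G := by
      simpa [hG0] using Polynomial.X_mul_divX_add G
    have hdiv : G.divX = 0 := by
      refine Polynomial.eq_zero_of_natDegree_lt_card_of_eval_eq_zero _ hx (fun i => ?_) ?_
      · have hi := hroot i
        rw [← hX, Polynomial.eval_mul, Polynomial.eval_X] at hi
        exact (mul_eq_zero.mp hi).resolve_left (hx0 i)
      · rw [Polynomial.natDegree_divX_eq_natDegree_tsub_one, Fintype.card_fin]
        omega
    exact hG (by rw [← hX, hdiv, mul_zero])
  · intro hM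
    have hlt : q.natDegree < M := by
      refine lt_of_le_of_ne hqdeg fun h => hq ?_
      rwa [← h, Polynomial.coeff_natDegree, Polynomial.leadingCoeff_eq_zero] at hM
    refine hG (Polynomial.eq_zero_of_natDegree_lt_card_of_eval_eq_zero _ hx hroot ?_)
    rw [Fintype.card_fin]
    omega

/-- The polynomial `∑ⱼ cⱼ Xʲ`. -/
def coeffPoly {m : ℕ} (c : Fin m → ℂ) : Polynomial ℂ :=
  ∑ j, Polynomial.C (c j) * Polynomial.X ^ (j : ℕ)

theorem eval_coeffPoly {m : ℕ} (c : Fin m → ℂ) (z : ℂ) :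
    (coeffPoly c).eval (Complex.exp (2 * z)) =
      ∑ j, c j * Complex.exp (2 * ((j : ℕ) : ℂ) * z) := by
  simp only [coeffPoly, Polynomial.eval_finsetSum, Polynomial.eval_mul, Polynomial.eval_C,
    Polynomial.eval_pow, Polynomial.eval_X, ← Complex.exp_nat_mul]
  exact Finset.sum_congr rfl fun j _ => by ring_nf

theorem natDegree_coeffPoly_le {m : ℕ} (c : Fin m → ℂ) : (coeffPoly c).natDegree ≤ m - 1 :=
  Polynomial.natDegree_sum_le_of_forall_le _ _ fun j _ =>
    (Polynomial.natDegree_C_mul_X_pow_le _ _).trans (by omega)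

theorem coeff_coeffPoly {m : ℕ} (c : Fin m → ℂ) (j : Fin m) : (coeffPoly c).coeff j = c j := by
  simp [coeffPoly, Polynomial.finsetSum_coeff, Polynomial.coeff_X_pow, Fin.val_inj]

theorem stmt_1 {N : ℕ} (hN : 1 ≤ N) (σ : Fin N → ℕ) (hσ : ∀ n, 1 ≤ σ n)
    (η : ℂ) (hη : ∀ r : ℚ, η ≠ (r : ℂ) * ((Real.pi : ℂ) * Complex.I))
    (ξ : Fin N → ℂ) (α : ℂ) (t : ℂ → ℂ) (ht : tForm N t)
    (NQ : ℕ) (c : Fin (NQ + 1) → ℂ) (Q : ℂ → ℂ)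
    (hQ : ∀ lam : ℂ, Q lam =
      Complex.exp (-(NQ : ℂ) * lam) * ∑ j, c j * Complex.exp (2 * ((j : ℕ) : ℂ) * lam))
    (F : ℂ → ℂ)
    (hF : ∀ lam : ℂ, F lam = t lam * Q lam
      + Complex.exp (lam - α) * afun η σ ξ lam * Q (lam - η)
      - Complex.exp (-lam - η + α) * dfun η σ ξ lam * Q (lam + η))
    (μ : Fin (N + NQ + 1) → ℂ)
    (hdist : ∀ i j, i ≠ j → ∀ k : ℤ, μ i - μ j ≠ (k : ℂ) * ((Real.pi : ℂ) * Complex.I))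
    (hvan : ∀ i, F (μ i) = 0) :
    (∀ lam : ℂ, Q lam = 0) ∨ (c 0 ≠ 0 ∧ c (Fin.last NQ) ≠ 0) := by
  obtain ⟨τ, hτ⟩ := ht
  obtain ⟨A, hAdeg, -, hA⟩ :=
    exists_polynomial_prod_sinh fun n => ξ n - ((σ n : ℂ) / 2) * η
  obtain ⟨D, hDdeg, hD0, hD⟩ :=
    exists_polynomial_prod_sinh fun n => ξ n + ((σ n : ℂ) / 2) * η
  have hQe (z : ℂ) : Complex.exp (NQ * z) * Q z = (coeffPoly c).eval (Complex.exp (2 * z)) := by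
    rw [hQ, eval_coeffPoly, ← mul_assoc, ← Complex.exp_add]
    simp
  have hte (z : ℂ) : Complex.exp ((N - 1) * z) * t z
      = (coeffPoly τ).eval (Complex.exp (2 * z)) := by
    rw [hτ, eval_coeffPoly, ← mul_assoc, ← Complex.exp_add]
    ring_nf
    simp
  by_cases hq : coeffPoly c = 0
  · left
    intro z
    have hz := hQe z
    rw [hq, Polynomial.eval_zero] at hz
    exact (mul_eq_zero.mp hz).resolve_left (Complex.exp_ne_zero _)
  right
  have hae (z : ℂ) : Complex.exp (N * z) * afun η σ ξ z = A.eval (Complex.exp (2 * z)) := by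
    rw [← hA, afun]
    simp only [sub_add]
  have hde (z : ℂ) : Complex.exp (N * z) * dfun η σ ξ z = D.eval (Complex.exp (2 * z)) := by
    rw [← hD, dfun]
    simp only [sub_sub]
  have hinj : Function.Injective fun i => Complex.exp (2 * μ i) := by
    intro i j hij
    by_contra hne
    obtain ⟨k, hk⟩ := Complex.exp_eq_exp_iff_exists_int.mp hij
    exact hdist i j hne k (by linear_combination hk / 2)
  have key := coeff_ne_zero_of_dilation_roots (N := N) (M := NQ) (T := coeffPoly τ)
    (A := Polynomial.C (Complex.exp (-α + NQ * η)) * A)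
    (D := Polynomial.C (Complex.exp (-η + α - NQ * η)) * D) (q := coeffPoly c)
    (u := Complex.exp (-(2 * η))) (v := Complex.exp (2 * η)) (Complex.exp_ne_zero _)
    (by simpa using hD0)
    ((natDegree_coeffPoly_le τ).trans (Nat.sub_le _ _))
    ((Polynomial.natDegree_C_mul_le _ _).trans hAdeg)
    ((Polynomial.natDegree_C_mul_le _ _).trans hDdeg)
    hq (natDegree_coeffPoly_le c) hinj (fun i => Complex.exp_ne_zero _) fun i => by
      have hi := hvan i
      rw [hF] at hi
      generalize μ i = z at hi ⊢
      have hm : Complex.exp (-(2 * η)) * Complex.exp (2 * z) = Complex.exp (2 * (z - η)) := by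
        rw [← Complex.exp_add]; ring_nf
      have hp : Complex.exp (2 * η) * Complex.exp (2 * z) = Complex.exp (2 * (z + η)) := by
        rw [← Complex.exp_add]; ring_nf
      simp only [Polynomial.eval_sub, Polynomial.eval_add, Polynomial.eval_mul, Polynomial.eval_X,
        Polynomial.eval_C, Polynomial.eval_comp, hm, hp, ← hQe, ← hte, ← hae, ← hde]
      have e1 : Complex.exp (2 * z) * Complex.exp ((N - 1) * z) * Complex.exp (NQ * z)
          = Complex.exp ((N + NQ + 1) * z) := by
        simp only [← Complex.exp_add]; ring_nf
      have e2 : Complex.exp (2 * z) * Complex.exp (-α + NQ * η) * Complex.exp (N * z)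
          * Complex.exp (NQ * (z - η))
          = Complex.exp ((N + NQ + 1) * z) * Complex.exp (z - α) := by
        simp only [← Complex.exp_add]; ring_nf
      have e3 : Complex.exp (-η + α - NQ * η) * Complex.exp (N * z) * Complex.exp (NQ * (z + η))
          = Complex.exp ((N + NQ + 1) * z) * Complex.exp (-z - η + α) := by
        simp only [← Complex.exp_add]; ring_nf
      linear_combination Complex.exp ((N + NQ + 1) * z) * hi + t z * Q z * e1
        + afun η σ ξ z * Q (z - η) * e2 - dfun η σ ξ z * Q (z + η) * e3
  have hfirst := coeff_coeffPoly c 0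
  have hlast := coeff_coeffPoly c (Fin.last NQ)
  rw [Fin.val_zero] at hfirst
  rw [Fin.val_last] at hlast
  rwa [hfirst, hlast] at key
end
end

section
/- Let α ∈ ℂ and let Q be of form (Q1) with root sum λ̄. Then the function Z(λ) = −e^{λ−α} a(λ) Q(λ−η) + e^{−λ−η+α} d(λ) Q(λ+η) + F_{α+λ̄}(λ) can be written as Z(λ) = e^{−(N_s+N−1)λ}·∑_{j=0}^{N_s+N−1} b_j e^{2jλ} for some complex coefficients b_0,…,b_{N_s+N−1}. -/
open Complex Finset

noncomputable section

/-- `f(λ) = e^{-nλ} P(e^{2λ})` for a polynomial `P` of degree at most `n` whose coefficients of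
degree `n` and `0` are `l` and `c`. -/
def IsTrigPoly (f : ℂ → ℂ) (n : ℕ) (l c : ℂ) : Prop :=
  ∃ P : Polynomial ℂ, P.natDegree ≤ n ∧ P.coeff n = l ∧ P.coeff 0 = c ∧
    ∀ z : ℂ, f z = Complex.exp (-(n : ℂ) * z) * P.eval (Complex.exp (2 * z))

namespace IsTrigPoly

lemma mul {f g : ℂ → ℂ} {m n : ℕ} {l c l' c' : ℂ} (hf : IsTrigPoly f m l c)
    (hg : IsTrigPoly g n l' c') :
    IsTrigPoly (fun z => f z * g z) (m + n) (l * l') (c * c') := by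
  obtain ⟨P, hP, rfl, rfl, hfP⟩ := hf
  obtain ⟨R, hR, rfl, rfl, hgR⟩ := hg
  refine ⟨P * R, Polynomial.natDegree_mul_le_of_le hP hR,
    Polynomial.coeff_mul_add_eq_of_natDegree_le hP hR, Polynomial.mul_coeff_zero P R, fun z => ?_⟩
  have h : Complex.exp (-((m + n : ℕ) : ℂ) * z)
      = Complex.exp (-(m : ℂ) * z) * Complex.exp (-(n : ℂ) * z) := by
    rw [← Complex.exp_add]
    congr 1
    push_cast
    ring
  simp only [hfP, hgR, h, Polynomial.eval_mul]
  ring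

lemma add {f g : ℂ → ℂ} {n : ℕ} {l c l' c' : ℂ} (hf : IsTrigPoly f n l c)
    (hg : IsTrigPoly g n l' c') :
    IsTrigPoly (fun z => f z + g z) n (l + l') (c + c') := by
  obtain ⟨P, hP, rfl, rfl, hfP⟩ := hf
  obtain ⟨R, hR, rfl, rfl, hgR⟩ := hg
  refine ⟨P + R, Polynomial.natDegree_add_le_of_degree_le hP hR, Polynomial.coeff_add P R n,
    Polynomial.coeff_add P R 0, fun z => ?_⟩
  simp only [hfP, hgR, Polynomial.eval_add]
  ring

lemma const (k : ℂ) : IsTrigPoly (fun _ => k) 0 k k :=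
  ⟨Polynomial.C k, by simp, by simp, by simp, fun z => by simp⟩

lemma exp_id : IsTrigPoly Complex.exp 1 1 0 := by
  refine ⟨Polynomial.X, Polynomial.natDegree_X_le, by simp, by simp, fun z => ?_⟩
  rw [Polynomial.eval_X, ← Complex.exp_add]
  congr 1
  push_cast
  ring

lemma exp_neg : IsTrigPoly (fun z => Complex.exp (-z)) 1 0 1 := by
  refine ⟨1, by simp, by simp [Polynomial.coeff_one], by simp, fun z => ?_⟩
  simp

lemma sinh_sub (k : ℂ) : IsTrigPoly (fun z => Complex.sinh (z - k)) 1
    (Complex.exp (-k) / 2) (-Complex.exp k / 2) := by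
  refine ⟨Polynomial.C (Complex.exp (-k) / 2) * Polynomial.X + Polynomial.C (-Complex.exp k / 2),
    Polynomial.natDegree_linear_le, by simp, by simp, fun z => ?_⟩
  have h₁ : Complex.exp (z - k)
      = Complex.exp (-z) * (Complex.exp (-k) * Complex.exp (2 * z)) := by
    rw [← Complex.exp_add, ← Complex.exp_add]
    congr 1
    ring
  have h₂ : Complex.exp (-(z - k)) = Complex.exp (-z) * Complex.exp k := by
    rw [← Complex.exp_add]
    congr 1
    ring
  simp only [Complex.sinh, h₁, h₂, Polynomial.eval_add, Polynomial.eval_mul, Polynomial.eval_C,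
    Polynomial.eval_X, Nat.cast_one, neg_one_mul]
  ring

lemma prod {ι : Type*} (s : Finset ι) {f : ι → ℂ → ℂ} {n : ι → ℕ} {l c : ι → ℂ}
    (h : ∀ i ∈ s, IsTrigPoly (f i) (n i) (l i) (c i)) :
    IsTrigPoly (fun z => ∏ i ∈ s, f i z) (∑ i ∈ s, n i) (∏ i ∈ s, l i) (∏ i ∈ s, c i) := by
  classical
  induction s using Finset.induction_on with
  | empty => simpa using const 1
  | insert a s ha ih =>
    simp only [Finset.prod_insert ha, Finset.sum_insert ha]
    exact (h a (Finset.mem_insert_self a s)).mul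
      (ih fun i hi => h i (Finset.mem_insert_of_mem hi))

lemma prod_sinh_sub {ι : Type*} (s : Finset ι) (k : ι → ℂ) :
    IsTrigPoly (fun z => ∏ i ∈ s, Complex.sinh (z - k i)) s.card
      (Complex.exp (-∑ i ∈ s, k i) / 2 ^ s.card)
      ((-1) ^ s.card * Complex.exp (∑ i ∈ s, k i) / 2 ^ s.card) := by
  have h := prod s fun i _ => sinh_sub (k i)
  convert h using 1
  · simp
  · rw [Finset.prod_div_distrib, ← Complex.exp_sum]
    simp
  · rw [Finset.prod_div_distrib, Finset.prod_neg, ← Complex.exp_sum]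
    simp

lemma exists_coeff {f : ℂ → ℂ} {n : ℕ} (hf : IsTrigPoly f (n + 1) 0 0) :
    ∃ b : Fin n → ℂ, ∀ z : ℂ,
      f z = Complex.exp (-((n : ℂ) - 1) * z)
        * ∑ j, b j * Complex.exp (2 * ((j : ℕ) : ℂ) * z) := by
  obtain ⟨P, hP, hl, hc, hfP⟩ := hf
  refine ⟨fun j => P.coeff (j + 1), fun z => ?_⟩
  have hexp : Complex.exp (-((n : ℂ) - 1) * z)
      = Complex.exp (-((n + 1 : ℕ) : ℂ) * z) * Complex.exp (2 * z) := by
    rw [← Complex.exp_add]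
    congr 1
    push_cast
    ring
  rw [hfP, hexp, mul_assoc, Polynomial.eval_eq_sum_range' (Nat.lt_succ_of_le hP),
    Finset.sum_range_succ, Finset.sum_range_succ', hl, hc,
    Fin.sum_univ_eq_sum_range (fun j : ℕ => P.coeff (j + 1) * Complex.exp (2 * (j : ℂ) * z)) n,
    Finset.mul_sum]
  simp only [zero_mul, add_zero]
  congr 1
  refine Finset.sum_congr rfl fun j _ => ?_
  have hj : Complex.exp (2 * (j : ℂ) * z) = Complex.exp (2 * z) ^ j := by
    rw [← Complex.exp_nat_mul]
    congr 1
    ring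
  rw [hj]
  ring

end IsTrigPoly

theorem stmt_2 {N : ℕ} (hN : 1 ≤ N) (σ : Fin N → ℕ) (hσ : ∀ n, 1 ≤ σ n)
    (η : ℂ) (hη : ∀ r : ℚ, η ≠ (r : ℂ) * ((Real.pi : ℂ) * Complex.I))
    (ξ : Fin N → ℂ) (α : ℂ)
    (Q : ℂ → ℂ) (μ : Fin (∑ n, σ n) → ℂ)
    (hQ : ∀ lam : ℂ, Q lam = ∏ j, Complex.sinh (lam - μ j)) :
    ∃ b : Fin ((∑ n, σ n) + N) → ℂ, ∀ lam : ℂ,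
      -Complex.exp (lam - α) * afun η σ ξ lam * Q (lam - η)
        + Complex.exp (-lam - η + α) * dfun η σ ξ lam * Q (lam + η)
        + Ffun η σ ξ (α + ∑ j, μ j) lam
      = Complex.exp (-(((∑ n, σ n : ℕ) : ℂ) + (N : ℂ) - 1) * lam)
          * ∑ j, b j * Complex.exp (2 * ((j : ℕ) : ℂ) * lam) := by
  revert μ hQ
  generalize hS : ∑ n, σ n = S
  intro μ hQ
  have hSc : (∑ n, (σ n : ℂ)) = S := by rw [← hS, Nat.cast_sum]
  set X : ℂ := ∑ n, ξ n with hX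
  set m : ℂ := ∑ j, μ j with hm
  set T : ℂ := ∑ j, ∑ h ∈ Finset.Icc 1 (σ j), xik η σ ξ j h with hT
  have hA : IsTrigPoly (afun η σ ξ) N (Complex.exp (-(X - S / 2 * η)) / 2 ^ N)
      ((-1) ^ N * Complex.exp (X - S / 2 * η) / 2 ^ N) := by
    have h := IsTrigPoly.prod_sinh_sub Finset.univ fun n => ξ n - (σ n : ℂ) / 2 * η
    rw [Finset.sum_sub_distrib, ← Finset.sum_mul, ← Finset.sum_div, hSc, Finset.card_fin] at h
    convert h using 1
    funext z
    exact Finset.prod_congr rfl fun n _ => by congr 1; ring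
  have hD : IsTrigPoly (dfun η σ ξ) N (Complex.exp (-(X + S / 2 * η)) / 2 ^ N)
      ((-1) ^ N * Complex.exp (X + S / 2 * η) / 2 ^ N) := by
    have h := IsTrigPoly.prod_sinh_sub Finset.univ fun n => ξ n + (σ n : ℂ) / 2 * η
    rw [Finset.sum_add_distrib, ← Finset.sum_mul, ← Finset.sum_div, hSc, Finset.card_fin] at h
    convert h using 1
    funext z
    exact Finset.prod_congr rfl fun n _ => by congr 1; ring
  have hQshift (k : ℂ) : IsTrigPoly (fun z => Q (z - k)) S (Complex.exp (-(m + S * k)) / 2 ^ S)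
      ((-1) ^ S * Complex.exp (m + S * k) / 2 ^ S) := by
    have h := IsTrigPoly.prod_sinh_sub Finset.univ fun j => μ j + k
    rw [Finset.sum_add_distrib, Finset.sum_const, Finset.card_fin, nsmul_eq_mul] at h
    convert h using 1
    funext z
    rw [hQ]
    exact Finset.prod_congr rfl fun n _ => by congr 1; ring
  have hP : IsTrigPoly (fun z => ∏ j, ∏ h ∈ Finset.range (σ j + 1), Complex.sinh (z - xik η σ ξ j h))
      (S + N) (Complex.exp (-(T + (X + S / 2 * η))) / 2 ^ (S + N))
      ((-1) ^ (S + N) * Complex.exp (T + (X + S / 2 * η)) / 2 ^ (S + N)) := by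
    have h := IsTrigPoly.prod_sinh_sub
      (Finset.univ.sigma fun j : Fin N => Finset.range (σ j + 1)) fun p => xik η σ ξ p.1 p.2
    have hcard : (Finset.univ.sigma fun j : Fin N => Finset.range (σ j + 1)).card = S + N := by
      simp [Finset.card_sigma, Finset.sum_add_distrib, hS]
    have hsum : ∑ p ∈ Finset.univ.sigma fun j : Fin N => Finset.range (σ j + 1),
        xik η σ ξ p.1 p.2 = T + (X + S / 2 * η) := by
      have h₀ : X + S / 2 * η = ∑ j, xik η σ ξ j 0 := by
        simp only [xik, Nat.cast_zero, sub_zero]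
        rw [Finset.sum_add_distrib, ← Finset.sum_mul, ← Finset.sum_div, hSc]
      rw [Finset.sum_sigma, h₀, hT, ← Finset.sum_add_distrib]
      refine Finset.sum_congr rfl fun j _ => ?_
      rw [Finset.sum_range_succ', Finset.range_eq_Ico,
        Finset.sum_Ico_add' (fun h => xik η σ ξ j h) 0 (σ j) 1]
      rfl
    rw [hcard, hsum] at h
    simpa only [Finset.prod_sigma] using h
  have h₁ := ((IsTrigPoly.const (-Complex.exp (-α))).mul IsTrigPoly.exp_id).mul
    (hA.mul (hQshift η))
  have h₂ := ((IsTrigPoly.const (Complex.exp (α - η))).mul IsTrigPoly.exp_neg).mul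
    (hD.mul (hQshift (-η)))
  have h₃ := ((IsTrigPoly.const (2 * Complex.exp (-((S : ℂ) + 1) * η / 2))).mul
    (IsTrigPoly.sinh_sub (α + m - T - ((S : ℂ) + 1) * η / 2))).mul hP
  rw [show 0 + 1 + (N + S) = S + N + 1 by ring] at h₁ h₂
  rw [show 0 + 1 + (S + N) = S + N + 1 by ring] at h₃
  have hZ := (h₁.add h₂).add h₃
  have htop : Complex.exp (-α) * Complex.exp (-(X - S / 2 * η)) * Complex.exp (-(m + S * η))
      = Complex.exp (-((S : ℂ) + 1) * η / 2)
        * Complex.exp (-(α + m - T - ((S : ℂ) + 1) * η / 2))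
        * Complex.exp (-(T + (X + S / 2 * η))) := by
    simp only [← Complex.exp_add]
    congr 1
    ring
  have hbot : Complex.exp (α - η) * Complex.exp (X + S / 2 * η) * Complex.exp (m + S * (-η))
      = Complex.exp (-((S : ℂ) + 1) * η / 2)
        * Complex.exp (α + m - T - ((S : ℂ) + 1) * η / 2)
        * Complex.exp (T + (X + S / 2 * η)) := by
    simp only [← Complex.exp_add]
    congr 1
    ring
  have hZ' : IsTrigPoly (fun lam => -Complex.exp (lam - α) * afun η σ ξ lam * Q (lam - η)
      + Complex.exp (-lam - η + α) * dfun η σ ξ lam * Q (lam + η)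
      + Ffun η σ ξ (α + m) lam) (S + N + 1) 0 0 := by
    convert hZ using 1
    · funext z
      have e₁ : Complex.exp (z - α) = Complex.exp (-α) * Complex.exp z := by
        rw [← Complex.exp_add]
        congr 1
        ring
      have e₂ : Complex.exp (-z - η + α) = Complex.exp (α - η) * Complex.exp (-z) := by
        rw [← Complex.exp_add]
        congr 1
        ring
      have e₃ : z - (α + m) + T + ((S : ℂ) + 1) * η / 2
          = z - (α + m - T - ((S : ℂ) + 1) * η / 2) := by ring
      simp only [Ffun, hS, ← hT, e₁, e₂, e₃, sub_neg_eq_add]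
      ring
    · linear_combination (1 / 2 ^ (S + N)) * htop
    · linear_combination (-(-1) ^ (S + N) / 2 ^ (S + N)) * hbot
  obtain ⟨b, hb⟩ := hZ'.exists_coeff
  refine ⟨b, fun lam => ?_⟩
  rw [hb lam]
  push_cast
  rfl
end
end

section
/- Assume condition (C). Let α ∈ ℂ, let t : ℂ → ℂ be of t-form, and let Q be of form (Q1) with Q(ξ_j^{(0)}) ≠ 0 for every j = 1,…,N, such that the inhomogeneous T-Q equation holds: t(λ)Q(λ) = −e^{λ−α} a(λ) Q(λ−η) + e^{−λ−η+α} d(λ) Q(λ+η) + F_{α+λ̄}(λ) for all λ ∈ ℂ. Then det D_t^{(n)} = 0 for every n = 1,…,N. -/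
open Complex Finset

noncomputable section

lemma xik_succ {N : ℕ} (η : ℂ) (σ : Fin N → ℕ) (ξ : Fin N → ℂ) (n : Fin N) (k : ℕ) :
    xik η σ ξ n (k + 1) = xik η σ ξ n k - η := by
  simp only [xik]
  push_cast
  ring

lemma afun_xik_last {N : ℕ} (η : ℂ) (σ : Fin N → ℕ) (ξ : Fin N → ℂ) (n : Fin N) :
    afun η σ ξ (xik η σ ξ n (σ n)) = 0 := by
  refine Finset.prod_eq_zero (Finset.mem_univ n) ?_
  rw [← Complex.sinh_zero]
  congr 1
  simp only [xik]
  ring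

lemma dfun_xik_zero {N : ℕ} (η : ℂ) (σ : Fin N → ℕ) (ξ : Fin N → ℂ) (n : Fin N) :
    dfun η σ ξ (xik η σ ξ n 0) = 0 := by
  refine Finset.prod_eq_zero (Finset.mem_univ n) ?_
  rw [← Complex.sinh_zero]
  congr 1
  simp only [xik]
  push_cast
  ring

lemma Ffun_xik {N : ℕ} (η : ℂ) (σ : Fin N → ℕ) (ξ : Fin N → ℂ) (x : ℂ) (n : Fin N) {k : ℕ}
    (hk : k ≤ σ n) : Ffun η σ ξ x (xik η σ ξ n k) = 0 := by
  refine mul_eq_zero_of_right _ (Finset.prod_eq_zero (Finset.mem_univ n) ?_)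
  exact Finset.prod_eq_zero (Finset.mem_range.2 (Nat.lt_succ_of_le hk)) (by simp)

/-- Rows of `Dmat` acting on a sequence: the three-term recurrence, valid also at both ends because
the off-diagonal coefficients vanish there. -/
lemma Dmat_mulVec_eq_zero {N : ℕ} (η : ℂ) (σ : Fin N → ℕ) (ξ : Fin N → ℂ) (t : ℂ → ℂ) (n : Fin N)
    (v : ℕ → ℂ) (h_zero : t (xik η σ ξ n 0) * v 0 + afun η σ ξ (xik η σ ξ n 0) * v 1 = 0)
    (h_succ : ∀ k < σ n, t (xik η σ ξ n (k + 1)) * v (k + 1)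
      + afun η σ ξ (xik η σ ξ n (k + 1)) * v (k + 2)
      - dfun η σ ξ (xik η σ ξ n (k + 1)) * v k = 0) :
    (Dmat η σ ξ t n).mulVec (fun k => v k) = 0 := by
  ext ⟨h, hh⟩
  have entry_mul : ∀ k : ℕ,
      (if h = k then t (xik η σ ξ n h)
        else if k = h + 1 then afun η σ ξ (xik η σ ξ n h)
        else if h = k + 1 then -(dfun η σ ξ (xik η σ ξ n h)) else 0) * v k
      = (if h = k then t (xik η σ ξ n h) * v k else 0)
        + (if h + 1 = k then afun η σ ξ (xik η σ ξ n h) * v k else 0)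
        + (if h = k + 1 then -(dfun η σ ξ (xik η σ ξ n h)) * v k else 0) := by
    intro k
    split_ifs <;> first | omega | simp
  simp only [Matrix.mulVec, dotProduct, Dmat, Matrix.of_apply, Pi.zero_apply]
  rw [Fin.sum_univ_eq_sum_range (fun k : ℕ =>
      (if h = k then t (xik η σ ξ n h)
        else if k = h + 1 then afun η σ ξ (xik η σ ξ n h)
        else if h = k + 1 then -(dfun η σ ξ (xik η σ ξ n h)) else 0) * v k) (σ n + 1)]
  have upper : (if h + 1 ∈ Finset.range (σ n + 1) then afun η σ ξ (xik η σ ξ n h) * v (h + 1) else 0)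
      = afun η σ ξ (xik η σ ξ n h) * v (h + 1) := by
    split_ifs with hr
    · rfl
    · obtain rfl : h = σ n := by
        rw [Finset.mem_range] at hr
        omega
      rw [afun_xik_last, zero_mul]
  rw [Finset.sum_congr rfl fun k _ => entry_mul k, Finset.sum_add_distrib, Finset.sum_add_distrib,
    Finset.sum_ite_eq, Finset.sum_ite_eq, upper, if_pos (Finset.mem_range.2 hh)]
  cases h with
  | zero => simpa using h_zero
  | succ m =>
    have hm : m < σ n := by omega
    simp only [Nat.add_right_cancel_iff]
    rw [Finset.sum_ite_eq, if_pos (Finset.mem_range.2 (by omega))]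
    linear_combination h_succ m hm

theorem stmt_3 {N : ℕ} (hN : 1 ≤ N) (σ : Fin N → ℕ) (hσ : ∀ n, 1 ≤ σ n)
    (η : ℂ) (hη : ∀ r : ℚ, η ≠ (r : ℂ) * ((Real.pi : ℂ) * Complex.I))
    (ξ : Fin N → ℂ) (hC : CondC η σ ξ)
    (α : ℂ) (t : ℂ → ℂ) (ht : tForm N t)
    (Q : ℂ → ℂ) (μ : Fin (∑ n, σ n) → ℂ)
    (hQ : ∀ lam : ℂ, Q lam = ∏ j, Complex.sinh (lam - μ j))
    (hQ0 : ∀ j : Fin N, Q (xik η σ ξ j 0) ≠ 0)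
    (heq : ∀ lam : ℂ, t lam * Q lam =
      -Complex.exp (lam - α) * afun η σ ξ lam * Q (lam - η)
        + Complex.exp (-lam - η + α) * dfun η σ ξ lam * Q (lam + η)
        + Ffun η σ ξ (α + ∑ j, μ j) lam) :
    ∀ n : Fin N, (Dmat η σ ξ t n).det = 0 := by
  intro n
  set c : ℕ → ℂ := fun k => ∏ i ∈ Finset.range k, Complex.exp (xik η σ ξ n i - α) with hc
  have c_succ : ∀ k, c (k + 1) = c k * Complex.exp (xik η σ ξ n k - α) :=
    fun k => Finset.prod_range_succ _ k
  refine Matrix.exists_mulVec_eq_zero_iff.1 ⟨fun k => c k * Q (xik η σ ξ n k), fun hv => ?_,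
    Dmat_mulVec_eq_zero η σ ξ t n (fun k => c k * Q (xik η σ ξ n k)) ?_ fun k hk => ?_⟩
  · exact hQ0 n (by simpa [hc] using congrFun hv 0)
  · have h := heq (xik η σ ξ n 0)
    rw [Ffun_xik η σ ξ _ n (Nat.zero_le _), dfun_xik_zero, ← xik_succ] at h
    simp only [c_succ 0, zero_add] at h ⊢
    linear_combination c 0 * h
  · have h := heq (xik η σ ξ n (k + 1))
    rw [Ffun_xik η σ ξ _ n hk, ← xik_succ, xik_succ η σ ξ n k, sub_add_cancel,
      ← xik_succ] at h
    have cancel : Complex.exp (xik η σ ξ n k - α)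
        * Complex.exp (-xik η σ ξ n (k + 1) - η + α) = 1 := by
      rw [← Complex.exp_add, ← Complex.exp_zero, xik_succ]
      congr 1
      ring
    simp only [c_succ (k + 1)]
    rw [c_succ k]
    linear_combination c k * Complex.exp (xik η σ ξ n k - α) * h
      + c k * dfun η σ ξ (xik η σ ξ n (k + 1)) * Q (xik η σ ξ n k) * cancel
end
end

section
/- Let ε ∈ {−1, +1} and let Q be of form (Q2) satisfying the Wronskian relation with ε. Then for all λ ∈ ℂ one has the identity [Q(λ+η)Q(λ+iπ−η) − Q(λ+η+iπ)Q(λ−η)]·Q(λ) = w_ε(λ)·[−a(λ)Q(λ−η) + d(λ)Q(λ+η)]. In particular, if t : ℂ → ℂ is any function with t(λ)·w_ε(λ) = Q(λ+η)Q(λ+iπ−η) − Q(λ+η+iπ)Q(λ−η) for all λ, then t(λ)Q(λ) = −a(λ)Q(λ−η) + d(λ)Q(λ+η) holds at every λ with w_ε(λ) ≠ 0. -/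
open Complex Finset

noncomputable section

theorem mul_prod_Icc_succ {M : Type*} [CommMonoid M] (f : ℕ → M) (m : ℕ) :
    f 1 * ∏ h ∈ Finset.Icc 1 m, f (h + 1) = f (m + 1) * ∏ h ∈ Finset.Icc 1 m, f h := by
  induction m with
  | zero => simp
  | succ m ih =>
    rw [Finset.prod_Icc_succ_top (by omega), Finset.prod_Icc_succ_top (by omega), ← mul_assoc, ih,
      mul_comm, mul_comm (f (m + 1))]

theorem dfun_mul_wfun_add {N : ℕ} {σ : Fin N → ℕ} (hσ : ∀ n, 1 ≤ σ n) (η : ℂ) (ξ : Fin N → ℂ)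
    (ε lam : ℂ) :
    dfun η σ ξ (lam + η) * wfun η σ ξ ε (lam + η) = afun η σ ξ lam * wfun η σ ξ ε lam := by
  unfold dfun afun wfun
  rw [mul_left_comm, mul_left_comm (∏ n, _), ← Finset.prod_mul_distrib, ← Finset.prod_mul_distrib]
  congr 1
  refine Finset.prod_congr rfl fun n _ => ?_
  have h := mul_prod_Icc_succ (fun k => Complex.sinh (lam - xik η σ ξ n k)) (σ n - 1)
  rw [Nat.sub_add_cancel (hσ n)] at h
  convert h using 2
  · congr 1
    simp only [xik]
    push_cast
    ring
  · refine Finset.prod_congr rfl fun k _ => congrArg _ ?_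
    simp only [xik]
    push_cast
    ring
  · congr 1
    simp only [xik]
    ring

theorem stmt_10 {N : ℕ} (hN : 1 ≤ N) (σ : Fin N → ℕ) (hσ : ∀ n, 1 ≤ σ n)
    (η : ℂ) (hη : ∀ r : ℚ, η ≠ (r : ℂ) * ((Real.pi : ℂ) * Complex.I))
    (ξ : Fin N → ℂ)
    (ε : ℂ) (hε : ε = 1 ∨ ε = -1)
    (Q : ℂ → ℂ) (μ : Fin (∑ n, σ n) → ℂ)
    (hQ : ∀ lam : ℂ, Q lam = ∏ j, Complex.sinh ((lam - μ j) / 2))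
    (hWr : ∀ lam : ℂ,
      Q lam * Q (lam + (Real.pi : ℂ) * Complex.I - η)
        + Q (lam + (Real.pi : ℂ) * Complex.I) * Q (lam - η)
      = dfun η σ ξ lam * wfun η σ ξ ε lam) :
    (∀ lam : ℂ,
      (Q (lam + η) * Q (lam + (Real.pi : ℂ) * Complex.I - η)
        - Q (lam + η + (Real.pi : ℂ) * Complex.I) * Q (lam - η)) * Q lam
      = wfun η σ ξ ε lam *
          (-afun η σ ξ lam * Q (lam - η) + dfun η σ ξ lam * Q (lam + η))) ∧
    (∀ t : ℂ → ℂ,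
      (∀ lam : ℂ, t lam * wfun η σ ξ ε lam =
        Q (lam + η) * Q (lam + (Real.pi : ℂ) * Complex.I - η)
          - Q (lam + η + (Real.pi : ℂ) * Complex.I) * Q (lam - η)) →
      ∀ lam : ℂ, wfun η σ ξ ε lam ≠ 0 →
        t lam * Q lam = -afun η σ ξ lam * Q (lam - η) + dfun η σ ξ lam * Q (lam + η)) := by
  have key : ∀ lam : ℂ,
      (Q (lam + η) * Q (lam + (Real.pi : ℂ) * Complex.I - η)
        - Q (lam + η + (Real.pi : ℂ) * Complex.I) * Q (lam - η)) * Q lam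
      = wfun η σ ξ ε lam *
          (-afun η σ ξ lam * Q (lam - η) + dfun η σ ξ lam * Q (lam + η)) := by
    intro lam
    have h₀ := hWr lam
    have h₁ := hWr (lam + η)
    rw [dfun_mul_wfun_add hσ, add_sub_cancel_right,
      show lam + η + (Real.pi : ℂ) * Complex.I - η = lam + (Real.pi : ℂ) * Complex.I by ring] at h₁
    linear_combination Q (lam + η) * h₀ - Q (lam - η) * h₁
  refine ⟨key, fun t ht lam hw => mul_left_cancel₀ hw ?_⟩
  rw [← key lam, ← ht lam]
  ring
end
end

section
/- Assume condition (C). Let t : ℂ → ℂ be a trigonometric polynomial (Laurent polynomial in e^λ) with t(λ+iπ) = (−1)^{N−1} t(λ) for all λ, and let Q be of form (Q2) such that t(λ)Q(λ) = −a(λ)Q(λ−η) + d(λ)Q(λ+η) for all λ ∈ ℂ. Then there is a unique ε ∈ {−1, +1} such that Q satisfies the Wronskian relation with ε, and for this ε one has t(λ)·w_ε(λ) = Q(λ+η)Q(λ+iπ−η) − Q(λ+η+iπ)Q(λ−η) for all λ ∈ ℂ. -/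
open Complex Finset

noncomputable section

namespace Complex

theorem sinh_eq_zero_iff_exists_int {z : ℂ} :
    sinh z = 0 ↔ ∃ k : ℤ, z = k * ((Real.pi : ℂ) * I) := by
  have h : sinh z = 0 ↔ exp z = exp (-z) := by
    rw [sinh, div_eq_zero_iff, sub_eq_zero]
    simp
  rw [h, exp_eq_exp_iff_exists_int]
  refine exists_congr fun k => ⟨fun h => ?_, fun h => ?_⟩
  · linear_combination h / 2
  · linear_combination 2 * h

theorem dense_setOf_prod_sinh_ne_zero {ι : Type*} [Fintype ι] (ρ : ι → ℂ) :
    Dense {x : ℂ | ∏ i, sinh (x - ρ i) ≠ 0} := by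
  have hc : (⋃ i, Set.range fun k : ℤ => ρ i + k * ((Real.pi : ℂ) * I)).Countable :=
    Set.countable_iUnion fun i => Set.countable_range _
  refine (hc.dense_compl ℝ).mono fun x hx => ?_
  rw [Set.mem_ofPred_eq, Finset.prod_ne_zero_iff]
  intro i _ h0
  obtain ⟨k, hk⟩ := sinh_eq_zero_iff_exists_int.1 h0
  exact hx (Set.mem_iUnion.2 ⟨i, k, by simp only [← hk]; ring⟩)

theorem prod_sinh_half_sub {κ : Type*} [Fintype κ] (m : κ → ℂ) (x : ℂ) :
    ∏ k, sinh ((x - m k) / 2) =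
      (exp (-x / 2) / 2) ^ Fintype.card κ * exp (-(∑ k, m k) / 2) *
        ∏ k, (exp x - exp (m k)) := by
  have h : ∀ k, sinh ((x - m k) / 2) =
      exp (-x / 2) / 2 * exp (-(m k) / 2) * (exp x - exp (m k)) := fun k => by
    have e₁ : exp ((x - m k) / 2) = exp (-x / 2) * exp (-(m k) / 2) * exp x := by
      rw [← exp_add, ← exp_add]
      ring_nf
    have e₂ : exp (-((x - m k) / 2)) = exp (-x / 2) * exp (-(m k) / 2) * exp (m k) := by
      rw [← exp_add, ← exp_add]
      ring_nf
    rw [sinh, e₁, e₂]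
    ring
  simp_rw [h, prod_mul_distrib, prod_const, ← exp_sum, Finset.card_univ, ← sum_div,
    sum_neg_distrib]

end Complex

namespace Polynomial

theorem prod_X_sub_C_add_prod_X_sub_C_eq {R ι κ : Type*} [CommRing R] [IsDomain R] [Fintype ι]
    [Fintype κ] (hcard : Fintype.card κ = Fintype.card ι) (a b : κ → R) {v : ι → R}
    (hv : Function.Injective v) (h : ∀ i, ∏ k, (v i - a k) + ∏ k, (v i - b k) = 0) (y : R) :
    ∏ k, (y - a k) + ∏ k, (y - b k) = 2 * ∏ i, (y - v i) := by
  set V : R[X] := ∏ i, (X - C (v i)) with hV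
  have hdeg : ∀ c : κ → R, (∏ k, (X - C (c k)) - V).degree < (#(univ : Finset ι) : WithBot ℕ) := by
    intro c
    have hdV : V.degree = (#(univ : Finset ι) : WithBot ℕ) := by
      simp [hV, degree_prod]
    have hdc : (∏ k, (X - C (c k))).degree = V.degree := by
      rw [hdV]
      simp [degree_prod, hcard]
    rw [← hdV]
    refine degree_sub_lt_right hdc (monic_prod_X_sub_C v univ).ne_zero ?_
    rw [(monic_prod_X_sub_C c univ).leadingCoeff, (monic_prod_X_sub_C v univ).leadingCoeff]
  have key : ∏ k, (X - C (a k)) + ∏ k, (X - C (b k)) = 2 * V := by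
    refine Polynomial.eq_of_degree_sub_lt_of_eval_index_eq (v := v) univ hv.injOn ?_ ?_
    · have e : ∏ k, (X - C (a k)) + ∏ k, (X - C (b k)) - 2 * V =
          (∏ k, (X - C (a k)) - V) + (∏ k, (X - C (b k)) - V) := by ring
      rw [e]
      exact (degree_add_le _ _).trans_lt (max_lt (hdeg a) (hdeg b))
    · intro i _
      have h0 : ∏ j, (v i - v j) = 0 := prod_eq_zero (mem_univ i) (sub_self _)
      simp [hV, eval_prod, h, h0]
  simpa [hV, eval_prod] using congrArg (eval y) key

end Polynomial

/-- A sum of two products of `sinh ((x - m k) / 2)` with equal sums of shifts is determined, up to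
sign, by its zeros, if it has as many zeros modulo `2πi` as there are factors. -/
theorem exists_sign_prod_sinh_half_add {ι κ : Type*} [Fintype ι] [Fintype κ]
    (hcard : Fintype.card κ = Fintype.card ι) (m m' : κ → ℂ) (hm : ∑ k, m' k = ∑ k, m k)
    (v : ι → ℂ) (hv : Function.Injective fun i => exp (v i))
    (h : ∀ i, ∏ k, sinh ((v i - m k) / 2) + ∏ k, sinh ((v i - m' k) / 2) = 0) :
    ∃ ε : ℂ, (ε = 1 ∨ ε = -1) ∧ ∀ x,
      ∏ k, sinh ((x - m k) / 2) + ∏ k, sinh ((x - m' k) / 2) =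
        2 * ε * ∏ i, sinh ((x - v i) / 2) := by
  have hsum : ∀ x, ∏ k, sinh ((x - m k) / 2) + ∏ k, sinh ((x - m' k) / 2) =
      (exp (-x / 2) / 2) ^ Fintype.card κ * exp (-(∑ k, m k) / 2) *
        (∏ k, (exp x - exp (m k)) + ∏ k, (exp x - exp (m' k))) := fun x => by
    rw [prod_sinh_half_sub, prod_sinh_half_sub, hm]
    ring
  have hpoly := Polynomial.prod_X_sub_C_add_prod_X_sub_C_eq hcard (fun k => exp (m k))
    (fun k => exp (m' k)) hv fun i => by
      have hi := h i
      rw [hsum] at hi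
      exact (mul_eq_zero.1 hi).resolve_left (by simp)
  refine ⟨exp ((∑ i, v i - ∑ k, m k) / 2), ?_, fun x => ?_⟩
  · have h0 := hpoly 0
    simp only [zero_sub, prod_neg, ← exp_sum, hm, Finset.card_univ, hcard] at h0
    have hne : (2 * (-1) ^ Fintype.card ι : ℂ) ≠ 0 := by simp
    have hexp : exp (∑ k, m k) = exp (∑ i, v i) :=
      mul_left_cancel₀ hne (by linear_combination h0)
    rw [← sq_eq_one_iff, ← exp_nat_mul]
    have e : ((2 : ℕ) : ℂ) * ((∑ i, v i - ∑ k, m k) / 2) = ∑ i, v i - ∑ k, m k := by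
      push_cast
      ring
    rw [e, exp_sub, hexp, div_self (exp_ne_zero _)]
  · rw [hsum, hpoly, prod_sinh_half_sub v, hcard]
    have e : exp (-(∑ k, m k) / 2) =
        exp ((∑ i, v i - ∑ k, m k) / 2) * exp (-(∑ i, v i) / 2) := by
      rw [← exp_add]
      ring_nf
    rw [e]
    ring

theorem sinh_half_mul_sinh_half_add_pi (z : ℂ) :
    sinh (z / 2) * sinh ((z + (Real.pi : ℂ) * I) / 2) = I / 2 * sinh z := by
  have h₁ : sinh ((z + (Real.pi : ℂ) * I) / 2) = I * cosh (z / 2) := by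
    have e : (z + (Real.pi : ℂ) * I) / 2 = z / 2 + (Real.pi / 2 : ℂ) * I := by ring
    rw [e, sinh_add, cosh_mul_I, sinh_mul_I, Complex.cos_pi_div_two, Complex.sin_pi_div_two]
    ring
  have h₂ : sinh z = 2 * sinh (z / 2) * cosh (z / 2) := by
    rw [← sinh_two_mul]
    ring_nf
  rw [h₁, h₂]
  ring

/-- The quantum Wronskian of `Q(λ) = ∏ sinh ((λ - μ j) / 2)` and `Q(λ + iπ)`. -/
def quantumWronskian (η : ℂ) (Q : ℂ → ℂ) (x : ℂ) : ℂ :=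
  Q x * Q (x + (Real.pi : ℂ) * I - η) + Q (x + (Real.pi : ℂ) * I) * Q (x - η)

theorem exists_sign_quantumWronskian_eq {ι κ : Type*} [Fintype ι] [Fintype κ]
    (hcard : Fintype.card κ = Fintype.card ι) (η : ℂ) (μ : κ → ℂ) {Q : ℂ → ℂ}
    (hQ : ∀ x, Q x = ∏ j, sinh ((x - μ j) / 2)) (ρ : ι → ℂ)
    (hρ : ∀ i j, ∀ k : ℤ, ρ i = ρ j + k * ((Real.pi : ℂ) * I) → i = j)
    (h : ∀ i, quantumWronskian η Q (ρ i) = 0) :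
    ∃ ε : ℂ, (ε = 1 ∨ ε = -1) ∧ ∀ x, quantumWronskian η Q x =
      2 * ε * (I / 2) ^ Fintype.card ι * ∏ i, sinh (x - ρ i) := by
  have hper : ∀ x, Q (x + 2 * (Real.pi * I)) = (-1) ^ Fintype.card κ * Q x := fun x => by
    have e : ∀ j, sinh ((x + 2 * (Real.pi * I) - μ j) / 2) = -sinh ((x - μ j) / 2) := fun j => by
      rw [← sinh_add_pi_mul_I]
      ring_nf
    simp_rw [hQ, e, prod_neg, Finset.card_univ]
  have hanti : ∀ x, quantumWronskian η Q (x - Real.pi * I) =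
      (-1) ^ Fintype.card κ * quantumWronskian η Q x := fun x => by
    have e₁ := hper (x - Real.pi * I)
    have e₂ := hper (x - Real.pi * I - η)
    have a₁ : x - Real.pi * I + 2 * (Real.pi * I) = x + Real.pi * I := by ring
    have a₂ : x - Real.pi * I - η + 2 * (Real.pi * I) = x + Real.pi * I - η := by ring
    rw [a₁] at e₁
    rw [a₂] at e₂
    have hs : ((-1 : ℂ) ^ Fintype.card κ) * (-1) ^ Fintype.card κ = 1 := by
      rw [← mul_pow]
      simp
    simp only [quantumWronskian, sub_add_cancel, e₁, e₂]
    linear_combination (-(Q (x - Real.pi * I - η) * Q x + Q (x - Real.pi * I) * Q (x - η))) * hs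
  let m : κ ⊕ κ → ℂ := Sum.elim μ fun j => μ j + η - Real.pi * I
  let m' : κ ⊕ κ → ℂ := Sum.elim (fun j => μ j - Real.pi * I) fun j => μ j + η
  let v : ι ⊕ ι → ℂ := Sum.elim ρ fun i => ρ i - Real.pi * I
  have hW : ∀ x, ∏ k, sinh ((x - m k) / 2) + ∏ k, sinh ((x - m' k) / 2) =
      quantumWronskian η Q x := fun x => by
    have e₁ : ∀ j, x - (μ j + η - Real.pi * I) = x + Real.pi * I - η - μ j := fun j => by ring
    have e₂ : ∀ j, x - (μ j - Real.pi * I) = x + Real.pi * I - μ j := fun j => by ring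
    have e₃ : ∀ j, x - (μ j + η) = x - η - μ j := fun j => by ring
    simp only [m, m', quantumWronskian, Fintype.prod_sum_type, Sum.elim_inl, Sum.elim_inr, hQ,
      e₁, e₂, e₃]
  have hv : Function.Injective fun i => exp (v i) := by
    have hne : ∀ i j, exp (ρ i) ≠ exp (ρ j - Real.pi * I) := fun i j hij => by
      obtain ⟨k, hk⟩ := exp_eq_exp_iff_exists_int.1 hij
      have hij' := hρ i j (2 * k - 1) (by rw [hk]; push_cast; ring)
      subst hij'
      rw [exp_sub, exp_pi_mul_I] at hij
      have : exp (ρ i) = 0 := by linear_combination hij / 2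
      exact exp_ne_zero _ this
    rintro (i | i) (j | j) hij
    · obtain ⟨k, hk⟩ := exp_eq_exp_iff_exists_int.1 hij
      exact congrArg _ (hρ i j (2 * k) (by
        simp only [v, Sum.elim_inl] at hk
        rw [hk]; push_cast; ring))
    · exact absurd hij (hne i j)
    · exact absurd hij.symm (hne j i)
    · obtain ⟨k, hk⟩ := exp_eq_exp_iff_exists_int.1 hij
      exact congrArg _ (hρ i j (2 * k) (by
        simp only [v, Sum.elim_inr] at hk
        push_cast
        linear_combination hk))
  obtain ⟨ε, hε, hprod⟩ := exists_sign_prod_sinh_half_add (by simp [hcard]) m m'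
    (by simp only [m, m', Fintype.sum_sum_type, Sum.elim_inl, Sum.elim_inr, sum_add_distrib,
          sum_sub_distrib]; ring)
    v hv (by
      rintro (i | i)
      · rw [hW]
        exact h i
      · rw [hW]
        simp only [v, Sum.elim_inr, hanti, h, mul_zero])
  refine ⟨ε, hε, fun x => ?_⟩
  have e : ∀ i, sinh ((x - ρ i) / 2) * sinh ((x - (ρ i - Real.pi * I)) / 2) =
      I / 2 * sinh (x - ρ i) := fun i => by
    rw [← sinh_half_mul_sinh_half_add_pi]
    ring_nf
  rw [← hW, hprod, Fintype.prod_sum_type]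
  simp only [v, Sum.elim_inl, Sum.elim_inr]
  rw [← prod_mul_distrib]
  simp_rw [e, prod_mul_distrib, prod_const, Finset.card_univ]
  ring

section InhomogeneousChain

variable {N : ℕ} {η : ℂ} {σ : Fin N → ℕ} {ξ : Fin N → ℂ}

theorem intCast_mul_ne_intCast_mul_pi (hη : ∀ r : ℚ, η ≠ (r : ℂ) * ((Real.pi : ℂ) * I))
    {l : ℤ} (hl : l ≠ 0) (k : ℤ) : (l : ℂ) * η ≠ k * ((Real.pi : ℂ) * I) := by
  intro h
  have hl' : (l : ℂ) ≠ 0 := Int.cast_ne_zero.2 hl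
  refine hη (k / l) ?_
  push_cast
  field_simp
  linear_combination h

theorem xik_eq_xik_add_int_mul_pi (hη : ∀ r : ℚ, η ≠ (r : ℂ) * ((Real.pi : ℂ) * I))
    (hC : CondC η σ ξ) {i j : Fin N} {k l : ℕ} (hk : k ≤ σ i) (hl : l ≤ σ j) {z : ℤ}
    (h : xik η σ ξ i k = xik η σ ξ j l + z * ((Real.pi : ℂ) * I)) : i = j ∧ k = l := by
  have hij : i = j := by
    by_contra hij
    have hmem : xik η σ ξ i k ∈ XiSet η σ ξ i ∩ XiSet η σ ξ j :=
      ⟨⟨k, hk, 0, by simp⟩, ⟨l, hl, z, h⟩⟩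
    rw [hC i j hij] at hmem
    exact hmem
  subst hij
  refine ⟨rfl, ?_⟩
  by_contra hkl
  refine intCast_mul_ne_intCast_mul_pi hη (l := l - k) (by omega) z ?_
  simp only [xik] at h
  push_cast
  linear_combination h

theorem afun_xik_ne_zero (hη : ∀ r : ℚ, η ≠ (r : ℂ) * ((Real.pi : ℂ) * I))
    (hC : CondC η σ ξ) {n : Fin N} {k : ℕ} (hk : k < σ n) : afun η σ ξ (xik η σ ξ n k) ≠ 0 := by
  rw [afun, prod_ne_zero_iff]
  intro j _ h0
  obtain ⟨z, hz⟩ := sinh_eq_zero_iff_exists_int.1 h0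
  obtain ⟨rfl, rfl⟩ := xik_eq_xik_add_int_mul_pi hη hC hk.le (le_refl (σ j)) (z := z) (by
    have e : xik η σ ξ j (σ j) = ξ j - (σ j : ℂ) / 2 * η := by
      simp only [xik]
      ring
    rw [e]
    linear_combination hz)
  exact lt_irrefl _ hk

theorem dfun_eq_prod_sinh (x : ℂ) : dfun η σ ξ x = ∏ n, sinh (x - xik η σ ξ n 0) := by
  refine prod_congr rfl fun n _ => ?_
  simp only [xik]
  push_cast
  ring_nf

theorem dfun_mul_wfun (hσ : ∀ n, 1 ≤ σ n) (ε x : ℂ) :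
    dfun η σ ξ x * wfun η σ ξ ε x =
      2 * ε * (I / 2) ^ (∑ n, σ n) *
        ∏ p : Σ n, Fin (σ n), sinh (x - xik η σ ξ p.1 p.2) := by
  have e : ∀ n, ∏ k : Fin (σ n), sinh (x - xik η σ ξ n k) = sinh (x - xik η σ ξ n 0) *
      ∏ k ∈ Icc 1 (σ n - 1), sinh (x - xik η σ ξ n k) := fun n => by
    rw [Fin.prod_univ_eq_prod_range (fun k => sinh (x - xik η σ ξ n k)) (σ n)]
    have hr : range (σ n) = insert 0 (Icc 1 (σ n - 1)) := by
      have := hσ n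
      ext k
      simp only [mem_range, mem_insert, mem_Icc]
      omega
    rw [hr, prod_insert (by simp)]
  rw [Fintype.prod_sigma, dfun_eq_prod_sinh, wfun]
  simp_rw [e, prod_mul_distrib]
  ring

theorem dfun_add_pi (x : ℂ) : dfun η σ ξ (x + Real.pi * I) = (-1) ^ N * dfun η σ ξ x := by
  have e : ∀ n, sinh (x + Real.pi * I - xik η σ ξ n 0) = -sinh (x - xik η σ ξ n 0) := fun n => by
    rw [← sinh_add_pi_mul_I]
    ring_nf
  simp [dfun_eq_prod_sinh, e, prod_neg]

theorem afun_add_pi (x : ℂ) : afun η σ ξ (x + Real.pi * I) = (-1) ^ N * afun η σ ξ x := by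
  have e : ∀ n, sinh (x + Real.pi * I - ξ n + (σ n : ℂ) / 2 * η) =
      -sinh (x - ξ n + (σ n : ℂ) / 2 * η) := fun n => by
    rw [← sinh_add_pi_mul_I]
    ring_nf
  simp [afun, e, prod_neg]

theorem continuous_wfun (ε : ℂ) : Continuous (wfun η σ ξ ε) := by
  unfold wfun
  fun_prop

variable {t Q : ℂ → ℂ}

theorem baxter_add_pi (hN : 1 ≤ N)
    (htper : ∀ x, t (x + (Real.pi : ℂ) * I) = (-1 : ℂ) ^ (N - 1) * t x)
    (heq : ∀ x, t x * Q x = -afun η σ ξ x * Q (x - η) + dfun η σ ξ x * Q (x + η)) (x : ℂ) :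
    -t x * Q (x + Real.pi * I) = -afun η σ ξ x * Q (x + Real.pi * I - η) +
      dfun η σ ξ x * Q (x + η + Real.pi * I) := by
  have h := heq (x + Real.pi * I)
  rw [htper, afun_add_pi, dfun_add_pi, add_right_comm x _ η] at h
  obtain ⟨M, rfl⟩ : ∃ M, N = M + 1 := ⟨N - 1, by omega⟩
  have hs : ((-1 : ℂ) ^ M) ≠ 0 := by simp
  rw [Nat.add_sub_cancel, pow_succ] at h
  exact mul_left_cancel₀ hs (by linear_combination -h)

theorem afun_mul_quantumWronskian (hN : 1 ≤ N)
    (htper : ∀ x, t (x + (Real.pi : ℂ) * I) = (-1 : ℂ) ^ (N - 1) * t x)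
    (heq : ∀ x, t x * Q x = -afun η σ ξ x * Q (x - η) + dfun η σ ξ x * Q (x + η)) (x : ℂ) :
    afun η σ ξ x * quantumWronskian η Q x = dfun η σ ξ x * quantumWronskian η Q (x + η) := by
  have h₁ := heq x
  have h₂ := baxter_add_pi hN htper heq x
  have e : x + η + Real.pi * I - η = x + Real.pi * I := by ring
  simp only [quantumWronskian, add_sub_cancel_right, e]
  linear_combination Q (x + Real.pi * I) * h₁ + Q x * h₂

theorem quantumWronskian_xik_eq_zero (hN : 1 ≤ N)
    (hη : ∀ r : ℚ, η ≠ (r : ℂ) * ((Real.pi : ℂ) * I)) (hC : CondC η σ ξ)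
    (htper : ∀ x, t (x + (Real.pi : ℂ) * I) = (-1 : ℂ) ^ (N - 1) * t x)
    (heq : ∀ x, t x * Q x = -afun η σ ξ x * Q (x - η) + dfun η σ ξ x * Q (x + η))
    (n : Fin N) (k : ℕ) (hk : k < σ n) : quantumWronskian η Q (xik η σ ξ n k) = 0 := by
  have hrec := afun_mul_quantumWronskian hN htper heq (xik η σ ξ n k)
  refine (mul_eq_zero.1 (hrec.trans ?_)).resolve_left (afun_xik_ne_zero hη hC hk)
  induction k with
  | zero =>
    have h0 : dfun η σ ξ (xik η σ ξ n 0) = 0 := by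
      rw [dfun_eq_prod_sinh]
      exact prod_eq_zero (mem_univ n) (by simp)
    rw [h0, zero_mul]
  | succ k ih =>
    have e : xik η σ ξ n (k + 1) + η = xik η σ ξ n k := by
      simp only [xik]
      push_cast
      ring
    have hk' : k < σ n := by omega
    have hrec' := afun_mul_quantumWronskian hN htper heq (xik η σ ξ n k)
    rw [e, (mul_eq_zero.1 (hrec'.trans (ih hk' hrec'))).resolve_left (afun_xik_ne_zero hη hC hk'),
      mul_zero]

end InhomogeneousChain

theorem stmt_11 {N : ℕ} (hN : 1 ≤ N) (σ : Fin N → ℕ) (hσ : ∀ n, 1 ≤ σ n)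
    (η : ℂ) (hη : ∀ r : ℚ, η ≠ (r : ℂ) * ((Real.pi : ℂ) * Complex.I))
    (ξ : Fin N → ℂ) (hC : CondC η σ ξ)
    (t : ℂ → ℂ) (P : ℤ →₀ ℂ)
    (htP : ∀ lam : ℂ, t lam = P.sum fun k ck => ck * Complex.exp ((k : ℂ) * lam))
    (htper : ∀ lam : ℂ,
      t (lam + (Real.pi : ℂ) * Complex.I) = (-1 : ℂ) ^ (N - 1) * t lam)
    (Q : ℂ → ℂ) (μ : Fin (∑ n, σ n) → ℂ)
    (hQ : ∀ lam : ℂ, Q lam = ∏ j, Complex.sinh ((lam - μ j) / 2))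
    (heq : ∀ lam : ℂ, t lam * Q lam =
      -afun η σ ξ lam * Q (lam - η) + dfun η σ ξ lam * Q (lam + η)) :
    ∃ ε : ℂ, (ε = 1 ∨ ε = -1) ∧
      (∀ lam : ℂ,
        Q lam * Q (lam + (Real.pi : ℂ) * Complex.I - η)
          + Q (lam + (Real.pi : ℂ) * Complex.I) * Q (lam - η)
        = dfun η σ ξ lam * wfun η σ ξ ε lam) ∧
      (∀ lam : ℂ, t lam * wfun η σ ξ ε lam =
        Q (lam + η) * Q (lam + (Real.pi : ℂ) * Complex.I - η)
          - Q (lam + η + (Real.pi : ℂ) * Complex.I) * Q (lam - η)) ∧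
      (∀ ε' : ℂ, (ε' = 1 ∨ ε' = -1) →
        (∀ lam : ℂ,
          Q lam * Q (lam + (Real.pi : ℂ) * Complex.I - η)
            + Q (lam + (Real.pi : ℂ) * Complex.I) * Q (lam - η)
          = dfun η σ ξ lam * wfun η σ ξ ε' lam) →
        ε' = ε) := by
  obtain ⟨ε, hε, hW⟩ := exists_sign_quantumWronskian_eq
    (ι := Σ n, Fin (σ n)) (by simp) η μ hQ (fun p => xik η σ ξ p.1 p.2)
    (by
      rintro ⟨i, k⟩ ⟨j, l⟩ z hz
      obtain ⟨rfl, hkl⟩ := xik_eq_xik_add_int_mul_pi hη hC k.2.le l.2.le hz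
      rw [Fin.ext hkl])
    fun p => quantumWronskian_xik_eq_zero hN hη hC htper heq p.1 p.2 p.2.2
  have hcard : Fintype.card (Σ n, Fin (σ n)) = ∑ n, σ n := by simp
  rw [hcard] at hW
  have hwr : ∀ x, quantumWronskian η Q x = dfun η σ ξ x * wfun η σ ξ ε x := fun x => by
    rw [hW, dfun_mul_wfun hσ]
  refine ⟨ε, hε, hwr, fun x => ?_, fun ε' _ hε' => ?_⟩
  · have ht : Continuous t := by
      rw [funext htP]
      unfold Finsupp.sum
      fun_prop
    have hQc : Continuous Q := by
      rw [funext hQ]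
      fun_prop
    have hd : Dense {x | dfun η σ ξ x ≠ 0} := by
      simp_rw [dfun_eq_prod_sinh]
      exact dense_setOf_prod_sinh_ne_zero _
    refine congrFun (Continuous.ext_on (f := fun x => t x * wfun η σ ξ ε x)
      (g := fun x => Q (x + η) * Q (x + (Real.pi : ℂ) * Complex.I - η)
        - Q (x + η + (Real.pi : ℂ) * Complex.I) * Q (x - η)) hd
      (ht.mul (continuous_wfun ε)) (by fun_prop) fun y hy => mul_left_cancel₀ hy ?_) x
    have h₁ := heq y
    have h₂ := baxter_add_pi hN htper heq y
    have h₃ := hwr y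
    simp only [quantumWronskian] at h₃
    linear_combination Q (y + Real.pi * I - η) * h₁ - Q (y - η) * h₂ - t y * h₃
  · obtain ⟨x, hx⟩ := (dense_setOf_prod_sinh_ne_zero
      fun p : Σ n, Fin (σ n) => xik η σ ξ p.1 p.2).nonempty
    have h := (hwr x).symm.trans (hε' x)
    rw [dfun_mul_wfun hσ, dfun_mul_wfun hσ] at h
    have hne : 2 * (I / 2) ^ (∑ n, σ n) *
        ∏ p : Σ n, Fin (σ n), sinh (x - xik η σ ξ p.1 p.2) ≠ 0 := mul_ne_zero (by simp) hx
    exact mul_left_cancel₀ hne (by linear_combination -h)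
end
end
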